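/- Let G be the group on generators a₀, a₁, ..., aₙ (n ≥ 3, p prime, m ≥ 2) with relations a₁^p = 1, a₂^{p^m} = 1, aᵢ^{p²} = 1 for 3 ≤ i ≤ n, a_{n-1}^p = a₀^p, [a₁,a₀] = 1, [aₙ,a₀] = a₁, [a_{i-1},a₀] = aᵢ^p for 3 ≤ i ≤ n, and [aᵢ,aⱼ] = 1 for 1 ≤ i < j ≤ n. Then the derived subgroup G' is the elementary abelian group generated by a₁, a₃^p, ..., aₙ^p, isomorphic to (Z/p)^{n-1}. -/

import Mathlib

/-- The relations defining the group `G_n(m,p)` (a generalization of group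
no. 92 of the Hall–Senior table) on generators `a₀, a₁, …, aₙ`. Commutators
are written `[x,y] = x⁻¹y⁻¹xy`. -/
def GnmpRels (n m p : ℕ) (hn : 3 ≤ n) : Set (FreeGroup (Fin (n + 1))) :=
  let a : Fin (n + 1) → FreeGroup (Fin (n + 1)) := fun i => FreeGroup.of i
  let a0 : FreeGroup (Fin (n + 1)) := a ⟨0, by omega⟩
  let a1 : FreeGroup (Fin (n + 1)) := a ⟨1, by omega⟩
  let a2 : FreeGroup (Fin (n + 1)) := a ⟨2, by omega⟩
  -- a₁ᵖ = 1
  {a1 ^ p} ∪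
  -- a₂^{pᵐ} = 1
  {a2 ^ p ^ m} ∪
  -- aᵢ^{p²} = 1 for 3 ≤ i ≤ n
  {w | ∃ i : ℕ, ∃ _ : 3 ≤ i, ∃ _ : i ≤ n, w = a ⟨i, by omega⟩ ^ p ^ 2} ∪
  -- a_{n-1}ᵖ = a₀ᵖ
  {a ⟨n - 1, by omega⟩ ^ p * (a0 ^ p)⁻¹} ∪
  -- [a₁, a₀] = 1
  {a1⁻¹ * a0⁻¹ * a1 * a0} ∪
  -- [aₙ, a₀] = a₁
  {(a ⟨n, by omega⟩)⁻¹ * a0⁻¹ * a ⟨n, by omega⟩ * a0 * a1⁻¹} ∪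
  -- [a_{i-1}, a₀] = aᵢᵖ for 3 ≤ i ≤ n
  {w | ∃ i : ℕ, ∃ _ : 3 ≤ i, ∃ _ : i ≤ n,
    w = (a ⟨i - 1, by omega⟩)⁻¹ * a0⁻¹ * a ⟨i - 1, by omega⟩ * a0 *
      (a ⟨i, by omega⟩ ^ p)⁻¹} ∪
  -- [aᵢ, aⱼ] = 1 for 1 ≤ i < j ≤ n
  {w | ∃ i j : ℕ, ∃ _ : 1 ≤ i, ∃ _ : i < j, ∃ _ : j ≤ n,
    w = (a ⟨i, by omega⟩)⁻¹ * (a ⟨j, by omega⟩)⁻¹ * a ⟨i, by omega⟩ *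
      a ⟨j, by omega⟩}

/-- If a generating set of `G` commutes modulo a normal subgroup `K`, then `K` contains the derived
subgroup of `G`. -/
theorem commutator_le_of_closure_eq_top {G : Type*} [Group G] {S : Set G}
    (hS : Subgroup.closure S = ⊤) {K : Subgroup G} [K.Normal]
    (h : ∀ x ∈ S, ∀ y ∈ S, x⁻¹ * y⁻¹ * x * y ∈ K) : commutator G ≤ K := by
  have hcomm : ∀ x ∈ QuotientGroup.mk' K '' S, ∀ y ∈ QuotientGroup.mk' K '' S,
      x * y = y * x := by
    rintro _ ⟨x, hx, rfl⟩ _ ⟨y, hy, rfl⟩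
    rw [← map_mul, ← map_mul, eq_comm]
    refine QuotientGroup.eq.2 ?_
    simpa [mul_assoc] using h x hx y hy
  have htop : Subgroup.closure (QuotientGroup.mk' K '' S) = ⊤ := by
    rw [← MonoidHom.map_closure, hS, ← MonoidHom.range_eq_map,
      MonoidHom.range_eq_top.2 (QuotientGroup.mk'_surjective K)]
  have hcl := Subgroup.isMulCommutative_closure hcomm
  rw [htop] at hcl
  refine Subgroup.Normal.quotient_commutative_iff_commutator_le.1 ⟨⟨fun x y => ?_⟩⟩
  exact congrArg Subtype.val (hcl.is_comm.comm ⟨x, trivial⟩ ⟨y, trivial⟩)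

/-- A subgroup generated by pairwise commuting elements `b i` with `b i ^ p = 1` is isomorphic to
`(ℤ/p)^ι` as soon as a homomorphism sends the `b i` to elements of an abelian group that are
independent modulo `p`. -/
theorem nonempty_closure_range_mulEquiv {G H M ι : Type*} [Group G] [Group H] [AddCommGroup M]
    [Fintype ι] {p : ℕ} (b : ι → G) (hb : ∀ i, b i ^ p = 1) (hcomm : ∀ i j, Commute (b i) (b j))
    (f : G →* H) (T : Multiplicative M →* H) (hT : Function.Injective T) (v : ι → M)
    (hv : ∀ i, f (b i) = T (Multiplicative.ofAdd (v i)))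
    (hind : ∀ c : ι → ℤ, ∑ i, c i • v i = 0 → ∀ i, (p : ℤ) ∣ c i) :
    Nonempty (↥(Subgroup.closure (Set.range b)) ≃* (ι → Multiplicative (ZMod p))) := by
  have key : ∀ i, ∃ φ : Multiplicative (ZMod p) →* G,
      ∀ k : ℤ, φ (Multiplicative.ofAdd (k : ZMod p)) = b i ^ k := by
    intro i
    refine ⟨AddMonoidHom.toMultiplicativeLeft
      (ZMod.lift p ⟨zmultiplesHom (Additive G) (Additive.ofMul (b i)), ?_⟩), fun k => ?_⟩
    · rw [zmultiplesHom_apply, natCast_zsmul, ← ofMul_pow, hb, ofMul_one]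
    · simp
  choose φ hφ using key
  have hsurj : ∀ x : Multiplicative (ZMod p), ∃ k : ℤ, Multiplicative.ofAdd (k : ZMod p) = x :=
    fun x => ZMod.intCast_surjective x.toAdd
  have hφcomm : Pairwise fun i j => ∀ x y, Commute (φ i x) (φ j y) := by
    intro i j _ x y
    obtain ⟨k, rfl⟩ := hsurj x
    obtain ⟨l, rfl⟩ := hsurj y
    rw [hφ, hφ]
    exact (hcomm i j).zpow_zpow k l
  have hrange : (MonoidHom.noncommPiCoprod φ hφcomm).range = Subgroup.closure (Set.range b) := by
    rw [MonoidHom.noncommPiCoprod_range]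
    refine le_antisymm (iSup_le fun i => ?_) ((Subgroup.closure_le _).2 ?_)
    · rintro _ ⟨x, rfl⟩
      obtain ⟨k, rfl⟩ := hsurj x
      rw [hφ]
      exact Subgroup.zpow_mem _ (Subgroup.subset_closure (Set.mem_range_self i)) k
    · rintro _ ⟨i, rfl⟩
      exact Subgroup.mem_iSup_of_mem i
        ⟨Multiplicative.ofAdd ((1 : ℤ) : ZMod p), by rw [hφ, zpow_one]⟩
  have hinj : Function.Injective (MonoidHom.noncommPiCoprod φ hφcomm) := by
    rw [injective_iff_map_eq_one]
    intro g hg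
    choose c hc using fun i => hsurj (g i)
    have hsum : T (Multiplicative.ofAdd (∑ i, c i • v i)) = 1 := by
      rw [← map_one f, ← hg, MonoidHom.noncommPiCoprod_apply, Finset.map_noncommProd, ofAdd_sum,
        ← Finset.noncommProd_eq_prod]
      refine (Finset.map_noncommProd _ _ _ T).trans
        (Finset.noncommProd_congr rfl (fun i _ => ?_) _)
      rw [← hc, hφ, map_zpow, hv, ofAdd_zsmul, map_zpow]
    have hzero := hind c (hT (hsum.trans (map_one T).symm))
    funext i
    rw [← hc, (ZMod.intCast_zmod_eq_zero_iff_dvd _ _).2 (hzero i)]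
    rfl
  exact ⟨((MonoidHom.ofInjective hinj).trans (MulEquiv.subgroupCongr hrange)).symm⟩

/-- Translations of an additive commutative group, as permutations. -/
def translationHom (R : Type*) [AddCommGroup R] : Multiplicative R →* Equiv.Perm R where
  toFun v := Equiv.addRight v.toAdd
  map_one' := by ext; simp
  map_mul' u v := by ext y; simp [add_comm, add_left_comm]

@[simp]
theorem translationHom_apply {R : Type*} [AddCommGroup R] (v : Multiplicative R) (y : R) :
    translationHom R v y = y + v.toAdd := rfl

theorem translationHom_injective (R : Type*) [AddCommGroup R] :
    Function.Injective (translationHom R) := by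
  intro u v h
  have := DFunLike.congr_fun h 0
  simpa using this

/-- The affine permutation `y ↦ (1 - s) y + x` of a commutative ring, where `s ^ 2 = 0`. -/
def affinePerm {R : Type*} [CommRing R] (s x : R) (hs : s * s = 0) : Equiv.Perm R where
  toFun y := (1 - s) * y + x
  invFun y := (1 + s) * (y - x)
  left_inv y := by linear_combination (-y) * hs
  right_inv y := by linear_combination (x - y) * hs

theorem affinePerm_pow_apply {R : Type*} [CommRing R] (s x : R) (hs : s * s = 0) (k : ℕ) (y : R) :
    (affinePerm s x hs ^ k) y = y - k * s * y + k * x - (k.choose 2 : ℕ) * s * x := by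
  induction k with
  | zero => simp
  | succ k ih =>
    rw [pow_succ', Equiv.Perm.mul_apply, ih, Nat.choose_succ_succ' k 1, Nat.choose_one_right]
    simp only [affinePerm, Equiv.coe_fn_mk]
    push_cast
    linear_combination (k * y + (k.choose 2 : R) * x) * hs

theorem translation_affinePerm_commutator {R : Type*} [CommRing R] (s x : R) (hs : s * s = 0)
    (v : R) :
    (translationHom R (Multiplicative.ofAdd v))⁻¹ * (affinePerm s x hs)⁻¹ *
      translationHom R (Multiplicative.ofAdd v) * affinePerm s x hs =
      translationHom R (Multiplicative.ofAdd (s * v)) := by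
  rw [mul_assoc, mul_assoc, inv_mul_eq_iff_eq_mul, inv_mul_eq_iff_eq_mul]
  ext y
  simp only [Equiv.Perm.mul_apply, translationHom_apply, toAdd_ofAdd, affinePerm, Equiv.coe_fn_mk]
  linear_combination v * hs

theorem natCast_mul_self_powerSeries_zmod (p : ℕ) : (p : PowerSeries (ZMod (p ^ 2))) * p = 0 := by
  rw [← Nat.cast_mul, ← sq, ← map_natCast (PowerSeries.C (R := ZMod (p ^ 2))),
    ZMod.natCast_self, map_zero]

/-- The image of the generator `aᵢ` (`i ≥ 1`) in the power series ring. -/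
noncomputable def gnmpVector (n p i : ℕ) : PowerSeries (ZMod (p ^ 2)) :=
  if i = 1 then p * (PowerSeries.X : PowerSeries (ZMod (p ^ 2))) ^ (n + 1) else PowerSeries.X ^ i

theorem gnmpVector_one (n p : ℕ) :
    gnmpVector n p 1 = (p : PowerSeries (ZMod (p ^ 2))) * PowerSeries.X ^ (n + 1) := if_pos rfl

theorem gnmpVector_of_two_le (n p : ℕ) {i : ℕ} (hi : 2 ≤ i) :
    gnmpVector n p i = PowerSeries.X ^ i := if_neg (by omega)

theorem isUnit_one_sub_natCast_mul_X {R : Type*} [CommRing R] (c : ℕ) :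
    IsUnit (1 - (c : PowerSeries R) * PowerSeries.X) := by
  rw [PowerSeries.isUnit_iff_constantCoeff]
  simp

/-- `G_n(m,p)` acts on the power series over `ℤ/p²` by affine permutations, `aᵢ` acting by the
translation by `gnmpVector n p i` for `i ≥ 1`. -/
theorem exists_gnmp_action (n m p : ℕ) (hm : 2 ≤ m) (hn : 3 ≤ n) :
    ∃ f : PresentedGroup (GnmpRels n m p hn) →* Equiv.Perm (PowerSeries (ZMod (p ^ 2))),
      ∀ (i : ℕ) (_ : 1 ≤ i) (hi : i < n + 1),
        f (PresentedGroup.of ⟨i, hi⟩) =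
          translationHom _ (Multiplicative.ofAdd (gnmpVector n p i)) := by
  obtain ⟨u, hu⟩ := isUnit_one_sub_natCast_mul_X (R := ZMod (p ^ 2)) (p.choose 2)
  have hpp := natCast_mul_self_powerSeries_zmod p
  let s := (p : PowerSeries (ZMod (p ^ 2))) * PowerSeries.X
  have hs : s * s = 0 := by
    simp only [s]
    linear_combination (PowerSeries.X : PowerSeries (ZMod (p ^ 2))) ^ 2 * hpp
  let x := ↑u⁻¹ * (PowerSeries.X : PowerSeries (ZMod (p ^ 2))) ^ (n - 1)
  have hx : (1 - (p.choose 2 : PowerSeries (ZMod (p ^ 2))) * PowerSeries.X) * x =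
      PowerSeries.X ^ (n - 1) := by rw [← hu, Units.mul_inv_cancel_left]
  let T := translationHom (PowerSeries (ZMod (p ^ 2)))
  let A : ℕ → Equiv.Perm (PowerSeries (ZMod (p ^ 2))) := fun i =>
    if i = 0 then affinePerm s x hs else T (Multiplicative.ofAdd (gnmpVector n p i))
  have hA0 : A 0 = affinePerm s x hs := rfl
  have hA : ∀ i, 1 ≤ i → A i = T (Multiplicative.ofAdd (gnmpVector n p i)) :=
    fun i hi => if_neg (by omega)
  have hv1 := gnmpVector_one n p
  have hv : ∀ i, 2 ≤ i → gnmpVector n p i = PowerSeries.X ^ i := fun i hi =>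
    gnmpVector_of_two_le n p hi
  have hpow : ∀ (k : ℕ) (w : PowerSeries (ZMod (p ^ 2))), (k : PowerSeries (ZMod (p ^ 2))) * w = 0 →
      T (Multiplicative.ofAdd w) ^ k = 1 := by
    intro k w h
    rw [← map_pow, ← ofAdd_nsmul, nsmul_eq_mul, h, ofAdd_zero, map_one]
  have hsq : ((p ^ 2 : ℕ) : PowerSeries (ZMod (p ^ 2))) = 0 := by
    rw [← map_natCast (PowerSeries.C (R := ZMod (p ^ 2))), ZMod.natCast_self, map_zero]
  have hrel : ∀ r ∈ GnmpRels n m p hn,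
      FreeGroup.lift (fun i : Fin (n + 1) => A i) r = 1 := by
    intro r hr
    simp only [GnmpRels, Set.mem_union, Set.mem_singleton_iff, Set.mem_ofPred_eq] at hr
    rcases hr with ((((((rfl | rfl) | ⟨i, hi, hin, rfl⟩) | rfl) | rfl) | rfl) |
      ⟨i, hi, hin, rfl⟩) | ⟨i, j, hi, hij, hj, rfl⟩ <;>
      simp only [map_mul, map_pow, map_inv, FreeGroup.lift_apply_of]
    · rw [hA 1 le_rfl]
      exact hpow _ _ (by rw [hv1, ← mul_assoc, hpp, zero_mul])
    · rw [hA 2 (by omega)]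
      refine hpow _ _ ?_
      obtain ⟨k, rfl⟩ := Nat.exists_eq_add_of_le hm
      rw [pow_add, Nat.cast_mul, hsq, zero_mul, zero_mul]
    · rw [hA i (by omega)]
      exact hpow _ _ (by rw [hsq, zero_mul])
    · rw [hA (n - 1) (by omega), hA0, mul_inv_eq_one, hv _ (by omega), ← map_pow, ← ofAdd_nsmul,
        nsmul_eq_mul]
      ext1 y
      rw [affinePerm_pow_apply, translationHom_apply, toAdd_ofAdd]
      linear_combination (PowerSeries.X * y) * hpp - p * hx
    · rw [hA 1 le_rfl, hA0, translation_affinePerm_commutator, hv1]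
      have : s * ((p : PowerSeries (ZMod (p ^ 2))) * PowerSeries.X ^ (n + 1)) = 0 := by
        simp only [s]
        linear_combination (PowerSeries.X : PowerSeries (ZMod (p ^ 2))) ^ (n + 2) * hpp
      rw [this, ofAdd_zero, map_one]
    · rw [hA n (by omega), hA 1 le_rfl, hA0, translation_affinePerm_commutator, mul_inv_eq_one,
        hv1, hv n (by omega), mul_assoc, ← pow_succ']
    · rw [hA i (by omega), hA (i - 1) (by omega), hA0, translation_affinePerm_commutator,
        mul_inv_eq_one, hv i (by omega), hv (i - 1) (by omega), mul_assoc, ← pow_succ',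
        Nat.sub_add_cancel (by omega), ← map_pow, ← ofAdd_nsmul, nsmul_eq_mul]
    · rw [hA i hi, hA j (by omega), mul_assoc, ← mul_inv_rev, inv_mul_eq_one]
      exact (Commute.all _ _).map T
  refine ⟨PresentedGroup.toGroup hrel, fun i hi hin => ?_⟩
  rw [PresentedGroup.toGroup.of]
  exact hA i hi

/-- Distinct powers of `X`, multiplied by `p`, are independent modulo `p` over `ℤ/p²`. -/
theorem dvd_of_sum_zsmul_natCast_mul_X_pow_eq_zero {ι : Type*} [Fintype ι] {p : ℕ} (hp : 0 < p)
    {e : ι → ℕ} (he : Function.Injective e) {c : ι → ℤ}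
    (h : ∑ i, c i • ((p : PowerSeries (ZMod (p ^ 2))) * PowerSeries.X ^ e i) = 0) (i : ι) :
    (p : ℤ) ∣ c i := by
  classical
  have hcoeff := congrArg (PowerSeries.coeff (e i)) h
  have hterm : ∀ j, PowerSeries.coeff (e i)
      (c j • ((p : PowerSeries (ZMod (p ^ 2))) * PowerSeries.X ^ e j)) =
      if i = j then ((c j * p : ℤ) : ZMod (p ^ 2)) else 0 := by
    intro j
    rw [map_zsmul, ← map_natCast PowerSeries.C, PowerSeries.coeff_C_mul_X_pow]
    simp [he.eq_iff]
  rw [map_sum, Finset.sum_congr rfl fun j _ => hterm j, Finset.sum_ite_eq, map_zero,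
    if_pos (Finset.mem_univ _), ZMod.intCast_zmod_eq_zero_iff_dvd] at hcoeff
  push_cast [sq] at hcoeff
  exact Int.dvd_of_mul_dvd_mul_right (by exact_mod_cast hp.ne') hcoeff

/-- The element `a₁` for `j = 0`, and `a_{j+2}ᵖ` for `j ≥ 1`. -/
def derivedGen {G : Type*} [Group G] (a : ℕ → G) (p j : ℕ) : G :=
  if j = 0 then a 1 else a (j + 2) ^ p

/-- The derived subgroup of a group whose generators satisfy the commutation relations of
`G_n(m,p)` and the relations `a₁ᵖ = 1`, `aᵢ^{p²} = 1` for `3 ≤ i ≤ n`. -/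
theorem commutator_eq_closure_derivedGen {G : Type*} [Group G] {n p : ℕ} (hn : 3 ≤ n) (a : ℕ → G)
    (htop : Subgroup.closure (a '' Set.Iic n) = ⊤) (ha1 : a 1 ^ p = 1)
    (happ : ∀ i, 3 ≤ i → i ≤ n → a i ^ p ^ 2 = 1) (h10 : Commute (a 1) (a 0))
    (hlast : (a n)⁻¹ * (a 0)⁻¹ * a n * a 0 = a 1)
    (hstep : ∀ i, 3 ≤ i → i ≤ n → (a (i - 1))⁻¹ * (a 0)⁻¹ * a (i - 1) * a 0 = a i ^ p)
    (hcomm : ∀ i j, 1 ≤ i → i ≤ n → 1 ≤ j → j ≤ n → Commute (a i) (a j)) :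
    commutator G = Subgroup.closure (Set.range fun j : Fin (n - 1) => derivedGen a p j) := by
  set K := Subgroup.closure (Set.range fun j : Fin (n - 1) => derivedGen a p j) with hK
  have hmem1 : a 1 ∈ K := Subgroup.subset_closure ⟨⟨0, by omega⟩, if_pos rfl⟩
  have hmem : ∀ i, 3 ≤ i → i ≤ n → a i ^ p ∈ K := fun i hi hin =>
    Subgroup.subset_closure ⟨⟨i - 2, by omega⟩, by
      simp only [derivedGen]
      rw [if_neg (by omega), Nat.sub_add_cancel (by omega)]⟩
  -- The `p`-th power of `g` commutes with `a₀` when `[g, a₀] = w` commutes with `g` and `wᵖ = 1`.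
  have hpow0 : ∀ g w : G, g⁻¹ * (a 0)⁻¹ * g * a 0 = w → Commute g w → w ^ p = 1 →
      Commute (g ^ p) (a 0) := by
    intro g w hw hgw hwp
    have hconj : (a 0)⁻¹ * g * a 0 = g * w := by rw [← hw]; group
    have hconjp : (a 0)⁻¹ * g ^ p * a 0 = g ^ p := by
      have := conj_pow (i := p) (a := (a 0)⁻¹) (b := g)
      rw [inv_inv, hconj, hgw.mul_pow, hwp, mul_one] at this
      exact this.symm
    rw [mul_assoc, inv_mul_eq_iff_eq_mul] at hconjp
    exact hconjp
  have hcomm0 : ∀ i, 3 ≤ i → i ≤ n → Commute (a i ^ p) (a 0) := by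
    intro i hi hin
    rcases hin.eq_or_lt with rfl | hlt
    · exact hpow0 _ _ hlast (hcomm _ _ (by omega) le_rfl le_rfl (by omega)) ha1
    · refine hpow0 _ _ (hstep (i + 1) (by omega) hlt)
        ((hcomm _ _ (by omega) (by omega) (by omega) hlt).pow_right p) ?_
      rw [← pow_mul, ← sq, happ (i + 1) (by omega) hlt]
  have hcenter : K ≤ Subgroup.center G := by
    have hcent : ∀ g : G, (∀ i ≤ n, Commute g (a i)) → g ∈ Subgroup.center G := by
      intro g hg
      have hle : Subgroup.closure (a '' Set.Iic n) ≤ Subgroup.centralizer {g} := by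
        rw [Subgroup.closure_le]
        rintro _ ⟨i, hi, rfl⟩
        exact Subgroup.mem_centralizer_singleton_iff.2 (hg i hi).symm
      rw [htop] at hle
      exact Subgroup.mem_center_iff.2 fun x =>
        Subgroup.mem_centralizer_singleton_iff.1 (hle (Subgroup.mem_top x))
    rw [hK, Subgroup.closure_le]
    rintro _ ⟨j, rfl⟩
    refine hcent _ fun i hin => ?_
    have hj := j.2
    simp only [derivedGen]
    split_ifs with h0
    · rcases Nat.eq_zero_or_pos i with rfl | hi
      · exact h10
      · exact hcomm _ _ le_rfl (by omega) hi hin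
    · rcases Nat.eq_zero_or_pos i with rfl | hi
      · exact hcomm0 _ (by omega) (by omega)
      · exact (hcomm _ _ (by omega) (by omega) hi hin).pow_left p
  have hnormal : K.Normal := ⟨fun k hk g => by
    rwa [Subgroup.mem_center_iff.1 (hcenter hk) g, mul_inv_cancel_right]⟩
  have hmemcomm : ∀ x y : G, x⁻¹ * y⁻¹ * x * y ∈ commutator G := fun x y => by
    simpa [commutatorElement_def, commutator_def] using
      Subgroup.commutator_mem_commutator (Subgroup.mem_top x⁻¹) (Subgroup.mem_top y⁻¹)
  have hmem0 : ∀ i ≤ n, (a i)⁻¹ * (a 0)⁻¹ * a i * a 0 ∈ K := by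
    intro i hin
    rcases hin.eq_or_lt with rfl | hlt
    · rwa [hlast]
    rcases Nat.lt_or_ge i 2 with hi | hi
    · have hc : Commute (a i) (a 0) := by interval_cases i <;> [exact Commute.refl _; exact h10]
      rw [mul_assoc, hc.eq]
      simp [mul_assoc]
    · have := hstep (i + 1) (by omega) hlt
      rw [Nat.add_sub_cancel] at this
      rw [this]
      exact hmem _ (by omega) hlt
  refine le_antisymm (commutator_le_of_closure_eq_top htop ?_) ((Subgroup.closure_le _).2 ?_)
  · rintro _ ⟨i, hi, rfl⟩ _ ⟨j, hj, rfl⟩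
    rcases Nat.eq_zero_or_pos j with rfl | hj0
    · exact hmem0 i hi
    rcases Nat.eq_zero_or_pos i with rfl | hi0
    · have := K.inv_mem (hmem0 j hj)
      simpa [mul_assoc] using this
    · rw [mul_assoc, (hcomm i j hi0 hi hj0 hj).eq]
      simp [mul_assoc]
  · rintro _ ⟨j, rfl⟩
    have hj := j.2
    simp only [derivedGen]
    split_ifs with h0
    · exact hlast ▸ hmemcomm _ _
    · exact hstep (j + 2) (by omega) (by omega) ▸ hmemcomm _ _

/-- For `G = G_n(m,p)`, the derived subgroup `G'` is the elementary abelian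
group generated by `a₁, a₃ᵖ, …, aₙᵖ`, isomorphic to `(ℤ/p)^{n-1}`. -/
theorem derived_subgroup_Gnmp (n m p : ℕ) (hp : p.Prime) (hm : 2 ≤ m)
    (hn : 3 ≤ n) :
    commutator (PresentedGroup (GnmpRels n m p hn)) =
      Subgroup.closure
        ({PresentedGroup.of ⟨1, by omega⟩} ∪
          {x | ∃ i : ℕ, ∃ _ : 3 ≤ i, ∃ _ : i ≤ n,
            x = (PresentedGroup.of ⟨i, by omega⟩ :
              PresentedGroup (GnmpRels n m p hn)) ^ p}) ∧
    Nonempty (↥(commutator (PresentedGroup (GnmpRels n m p hn))) ≃*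
      (Fin (n - 1) → Multiplicative (ZMod p))) := by
  let G := PresentedGroup (GnmpRels n m p hn)
  let a : ℕ → G := fun i => if h : i < n + 1 then PresentedGroup.of ⟨i, h⟩ else 1
  have ha : ∀ i (h : i < n + 1), PresentedGroup.of ⟨i, h⟩ = a i := fun i h => by
    simp only [a]
    rw [dif_pos h]
  have hrel : ∀ r ∈ GnmpRels n m p hn,
      FreeGroup.lift (fun i : Fin (n + 1) => a i) r = 1 := by
    intro r hr
    have hlift : FreeGroup.lift (fun i : Fin (n + 1) => a i) =
        PresentedGroup.mk (GnmpRels n m p hn) := by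
      ext i
      rw [FreeGroup.lift_apply_of, ← ha i i.2]
      rfl
    rw [hlift, PresentedGroup.one_of_mem hr]
  simp only [GnmpRels, Set.mem_union, Set.mem_singleton_iff, Set.mem_ofPred_eq, or_imp, forall_and,
    forall_eq, forall_exists_index, map_mul, map_pow, map_inv, FreeGroup.lift_apply_of] at hrel
  obtain ⟨⟨⟨⟨⟨⟨⟨ha1, -⟩, happ⟩, -⟩, h10⟩, hlast⟩, hstep⟩, hcomm⟩ := hrel
  replace happ : ∀ i, 3 ≤ i → i ≤ n → a i ^ p ^ 2 = 1 := fun i hi hin => by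
    simpa only [map_pow, FreeGroup.lift_apply_of] using happ _ i hi hin rfl
  replace hstep : ∀ i, 3 ≤ i → i ≤ n → (a (i - 1))⁻¹ * (a 0)⁻¹ * a (i - 1) * a 0 = a i ^ p :=
    fun i hi hin => by
      simpa only [map_mul, map_pow, map_inv, FreeGroup.lift_apply_of, mul_inv_eq_one]
        using hstep _ i hi hin rfl
  have hcommute : ∀ x y : G, x⁻¹ * y⁻¹ * x * y = 1 → Commute x y := fun x y h => by
    rw [mul_assoc, ← mul_inv_rev, inv_mul_eq_one] at h
    exact h.symm
  have hlt : ∀ i j, 1 ≤ i → i < j → j ≤ n → Commute (a i) (a j) := fun i j hi hij hj =>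
    hcommute _ _ <| by
      simpa only [map_mul, map_inv, FreeGroup.lift_apply_of] using hcomm _ i j hi hij hj rfl
  replace hcomm : ∀ i j, 1 ≤ i → i ≤ n → 1 ≤ j → j ≤ n → Commute (a i) (a j) := by
    intro i j hi hin hj hjn
    rcases lt_trichotomy i j with h | rfl | h
    · exact hlt i j hi h hjn
    · exact Commute.refl _
    · exact (hlt j i hj h hin).symm
  have htop : Subgroup.closure (a '' Set.Iic n) = ⊤ := by
    rw [← top_le_iff, ← PresentedGroup.closure_range_of]
    refine Subgroup.closure_mono ?_
    rintro _ ⟨i, rfl⟩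
    exact ⟨i, Nat.lt_succ_iff.1 i.2, (ha i i.2).symm⟩
  have hderived := commutator_eq_closure_derivedGen hn a htop ha1 happ (hcommute _ _ h10)
    (mul_inv_eq_one.1 hlast) hstep hcomm
  obtain ⟨f, hf⟩ := exists_gnmp_action n m p hm hn
  refine ⟨hderived.trans (congrArg Subgroup.closure (Set.ext fun x => ⟨?_, ?_⟩)), ?_⟩
  · rintro ⟨j, rfl⟩
    have hj := j.2
    simp only [derivedGen]
    split_ifs with h0
    · exact Or.inl (ha 1 _).symm
    · exact Or.inr ⟨j + 2, by omega, by omega, by rw [ha]⟩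
  · rintro (rfl | ⟨i, hi, hin, rfl⟩)
    · exact ⟨⟨0, by omega⟩, (ha 1 _).symm⟩
    · refine ⟨⟨i - 2, by omega⟩, ?_⟩
      simp only [derivedGen]
      rw [if_neg (by omega), Nat.sub_add_cancel (by omega), ha]
  · change Nonempty (↥(commutator G) ≃* _)
    rw [hderived]
    refine nonempty_closure_range_mulEquiv _ (fun j => ?_) (fun j k => ?_) f
      (translationHom _) (translationHom_injective _)
      (fun j => (p : PowerSeries (ZMod (p ^ 2))) * PowerSeries.X ^ (if j.1 = 0 then n + 1 else j.1 + 2)) (fun j => ?_)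
      (fun c hc => dvd_of_sum_zsmul_natCast_mul_X_pow_eq_zero hp.pos (fun j k hjk => ?_) hc)
    · have hj := j.2
      simp only [derivedGen]
      split_ifs with h0
      · exact ha1
      · rw [← pow_mul, ← sq, happ _ (by omega) (by omega)]
    · have hj := j.2
      have hk := k.2
      simp only [derivedGen]
      split_ifs with h0 h1 h1
      · exact Commute.refl _
      · exact (hcomm _ _ le_rfl (by omega) (by omega) (by omega)).pow_right p
      · exact (hcomm _ _ (by omega) (by omega) le_rfl (by omega)).pow_left p
      · exact (hcomm _ _ (by omega) (by omega) (by omega) (by omega)).pow_pow p p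
    · have hj := j.2
      simp only [derivedGen]
      split_ifs with h0
      · rw [← ha 1 (by omega), hf 1 le_rfl (by omega), gnmpVector_one]
      · rw [← ha (j + 2) (by omega), map_pow, hf _ (by omega) (by omega),
          gnmpVector_of_two_le n p (by omega), ← map_pow, ← ofAdd_nsmul, nsmul_eq_mul]
    · have hj := j.2
      have hk := k.2
      ext
      split_ifs at hjk <;> omega
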